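/- For every fixed integer k ≥ 1, there are (up to isomorphism) only finitely many k-vertex-critical (P_5, complement of (K_3+2P_1))-free graphs. -/

import Mathlib

open SimpleGraph

/-- `G` contains no induced subgraph isomorphic to `H`. -/
def HFree {W V : Type*} (H : SimpleGraph W) (G : SimpleGraph V) : Prop :=
  IsEmpty (H ↪g G)

/-- `G` is `k`-vertex-critical: `χ(G) = k` and deleting any vertex decreases
the chromatic number below `k`. -/
def IsKVertexCritical {V : Type*} (G : SimpleGraph V) (k : ℕ) : Prop :=
  G.chromaticNumber = k ∧ ∀ v : V, (G.induce {v}ᶜ).chromaticNumber < k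

/-- The star `K_{1,s}`: center `0`, leaves `1, …, s`. -/
def starGraph (s : ℕ) : SimpleGraph (Fin (s + 1)) :=
  SimpleGraph.fromRel (fun i _ => (i : ℕ) = 0)

/-- `K_{1,s} + P_1`: the disjoint union of the star `K_{1,s}`
(center `0`, leaves `1, …, s`) and the isolated vertex `s + 1`. -/
def starPlusP1 (s : ℕ) : SimpleGraph (Fin (s + 2)) :=
  SimpleGraph.fromRel (fun i j => (i : ℕ) = 0 ∧ (j : ℕ) ≠ 0 ∧ (j : ℕ) ≤ s)

/-- The complement of `K_3 + 2P_1`: vertices `0,1,2` pairwise nonadjacent,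
vertices `3,4` adjacent to everything else. -/
def coK3Plus2P1 : SimpleGraph (Fin 5) :=
  SimpleGraph.fromRel (fun i j => 3 ≤ (i : ℕ) ∨ 3 ≤ (j : ℕ))

open Finset

/-- Elementary form of being `P₅`-free: distinctness of the vertices is automatic. -/
def NoInducedP5 {V : Type*} (G : SimpleGraph V) : Prop :=
  ∀ a b c d e, G.Adj a b → G.Adj b c → G.Adj c d → G.Adj d e →
    ¬ G.Adj a c → ¬ G.Adj a d → ¬ G.Adj a e → ¬ G.Adj b d → ¬ G.Adj b e → ¬ G.Adj c e → False

theorem HFree.noInducedP5 {V : Type*} {G : SimpleGraph V} (h : HFree (pathGraph 5) G) :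
    NoInducedP5 G := by
  intro a b c d e hab hbc hcd hde hac had hae hbd hbe hce
  refine h.false ⟨⟨![a, b, c, d, e], ?_⟩, ?_⟩
  · have := hab.ne
    have := hbc.ne
    have := hcd.ne
    have := hde.ne
    have : a ≠ c := by rintro rfl; exact had hcd
    have : a ≠ d := by rintro rfl; exact hae hde
    have : a ≠ e := by rintro rfl; exact had hde.symm
    have : b ≠ d := by rintro rfl; exact had hab
    have : b ≠ e := by rintro rfl; exact hae hab
    have : c ≠ e := by rintro rfl; exact hbe hbc
    intro i j hij
    fin_cases i <;> fin_cases j <;> simp_all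
  · intro i j
    change G.Adj (![a, b, c, d, e] i) (![a, b, c, d, e] j) ↔ _
    fin_cases i <;> fin_cases j <;> simp_all [pathGraph_adj, G.adj_comm]

/-- Elementary form of being free of `K₂ ∨ 3K₁`, the complement of `K₃ + 2P₁`. -/
theorem HFree.not_three_indep_common {V : Type*} {G : SimpleGraph V} (h : HFree coK3Plus2P1 G)
    {u w x y z : V} (huw : G.Adj u w) (hux : G.Adj u x) (huy : G.Adj u y) (huz : G.Adj u z)
    (hwx : G.Adj w x) (hwy : G.Adj w y) (hwz : G.Adj w z) (nxy : x ≠ y) (nxz : x ≠ z)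
    (nyz : y ≠ z) (hxy : ¬ G.Adj x y) (hxz : ¬ G.Adj x z) (hyz : ¬ G.Adj y z) : False := by
  refine h.false ⟨⟨![x, y, z, u, w], ?_⟩, ?_⟩
  · have := huw.ne
    have := hux.ne
    have := huy.ne
    have := huz.ne
    have := hwx.ne
    have := hwy.ne
    have := hwz.ne
    intro i j hij
    fin_cases i <;> fin_cases j <;> simp_all
  · intro i j
    change G.Adj (![x, y, z, u, w] i) (![x, y, z, u, w] j) ↔ _
    fin_cases i <;> fin_cases j <;> simp_all [coK3Plus2P1, G.adj_comm]

open Classical in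
/-- Components of a `P₅`-free graph lie within distance three of each of their vertices. -/
theorem card_reachable_le {V : Type*} [Fintype V] {G : SimpleGraph V} (hP : NoInducedP5 G) {d : ℕ}
    (hd : ∀ v, #{w | G.Adj v w} ≤ d) (v : V) : #{w | G.Reachable v w} ≤ (d + 1) ^ 3 := by
  let f : Finset V → Finset V := fun S => S ∪ S.biUnion fun u => {w | G.Adj u w}
  have hf (S : Finset V) : #(f S) ≤ #S * (d + 1) := by
    have h₁ : #(S.biUnion fun u => ({w | G.Adj u w} : Finset V)) ≤ #S * d :=
      card_biUnion_le_card_mul _ _ _ fun u _ => hd u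
    have h₂ := card_union_le S (S.biUnion fun u => ({w | G.Adj u w} : Finset V))
    rw [mul_add, mul_one]
    exact h₂.trans (by omega)
  have mem_f (S : Finset V) (w : V) : w ∈ f S ↔ w ∈ S ∨ ∃ u ∈ S, G.Adj u w := by simp [f]
  have hball : #(f (f (f {v}))) ≤ (d + 1) ^ 3 := by
    calc #(f (f (f {v}))) ≤ #(f (f {v})) * (d + 1) := hf _
      _ ≤ #(f {v}) * (d + 1) * (d + 1) := by gcongr; exact hf _
      _ ≤ #{v} * (d + 1) * (d + 1) * (d + 1) := by gcongr; exact hf _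
      _ = (d + 1) ^ 3 := by simp; ring
  refine (card_le_card ?_).trans hball
  have hclosed : ∀ u w, G.Adj u w → u ∈ f (f (f {v})) → w ∈ f (f (f {v})) := by
    intro u w huw hu
    by_contra hw
    have hw₂ : w ∉ f (f {v}) := fun h => hw ((mem_f _ _).2 (.inl h))
    have hu₂ : u ∉ f (f {v}) := fun h => hw ((mem_f _ _).2 (.inr ⟨u, h, huw⟩))
    have hu₁ : u ∉ f {v} := fun h => hu₂ ((mem_f _ _).2 (.inl h))
    obtain ⟨b, hb, hbu⟩ := ((mem_f _ _).1 hu).resolve_left hu₂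
    have hb₁ : b ∉ f {v} := fun h => hu₂ ((mem_f _ _).2 (.inr ⟨b, h, hbu⟩))
    obtain ⟨a, ha, hab⟩ := ((mem_f _ _).1 hb).resolve_left hb₁
    have hva : G.Adj v a := by
      rcases (mem_f _ _).1 ha with h | ⟨x, hx, hxa⟩
      · exact absurd ((mem_f _ _).2 (.inr ⟨a, h, hab⟩)) hb₁
      · rwa [← mem_singleton.1 hx]
    have mono (S : Finset V) {x} (h : x ∈ S) : x ∈ f S := (mem_f _ _).2 (.inl h)
    have step (S : Finset V) {x y} (h : x ∈ S) (hxy : G.Adj x y) : y ∈ f S :=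
      (mem_f _ _).2 (.inr ⟨x, h, hxy⟩)
    exact hP v a b u w hva hab hbu huw
      (fun h => hb₁ (step _ (mem_singleton_self v) h))
      (fun h => hu₁ (step _ (mem_singleton_self v) h))
      (fun h => hw₂ (mono _ (step _ (mem_singleton_self v) h)))
      (fun h => hu₂ (step _ ha h)) (fun h => hw₂ (step _ ha h)) (fun h => hw (step _ hb h))
  intro w hw
  obtain ⟨p⟩ := (mem_filter.1 hw).2
  have hwalk : ∀ {x y : V}, G.Walk x y → x ∈ f (f (f {v})) → y ∈ f (f (f {v})) := by
    intro x y p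
    induction p with
    | nil => exact id
    | cons h _ ih => exact fun hx => ih (hclosed _ _ h hx)
  exact hwalk p (by simp [f])

/-- A size from which a separating family of vertices must contain a clique on `t` vertices. -/
def separatingBound : ℕ → ℕ
  | 0 => 0
  | t + 1 => (t + 1) * (separatingBound t + 2 * t + 1) + 1

open Classical in
/-- If the sets `A x` separate the points of a large `S`, incomparable sets belong to adjacent
vertices, and the sets of adjacent vertices share at most two points, then there is a large clique.
A largest maximal trace on `S` is searched recursively, and a vertex of another maximal trace is
adjacent to everything found there. -/
theorem exists_clique_of_separating {V ι : Type*}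
    (G : SimpleGraph V) (A : V → Finset ι) (t : ℕ) : ∀ (S : Finset ι) (X : Finset V),
      separatingBound t ≤ #S →
      (∀ i ∈ S, ∀ j ∈ S, i ≠ j → ∃ x ∈ X, i ∈ A x ∧ j ∉ A x) →
      (∀ x ∈ X, ∀ y ∈ X, ∀ i ∈ S, ∀ j ∈ S,
        i ∈ A x → i ∉ A y → j ∈ A y → j ∉ A x → G.Adj x y) →
      (∀ x ∈ X, ∀ y ∈ X, G.Adj x y → #(A x ∩ A y ∩ S) ≤ 2) →
      ∃ Y ⊆ X, G.IsNClique t Y := by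
  induction t with
  | zero => exact fun S X _ _ _ _ => ⟨∅, by simp, by simp⟩
  | succ t ih =>
    intro S X hS hsep hinc hadj
    have hS1 : 1 < #S := by
      refine lt_of_lt_of_le ?_ hS
      simp only [separatingBound]
      nlinarith [Nat.zero_le (separatingBound t)]
    have : Nonempty V := by
      obtain ⟨i, hi, j, hj, hij⟩ := one_lt_card.1 hS1
      obtain ⟨x, -⟩ := hsep i hi j hj hij
      exact ⟨x⟩
    let F : Finset (Finset ι) := (X.image fun x => A x ∩ S).filter (· ≠ S)
    let M : Finset (Finset ι) := F.filter (Maximal (· ∈ F))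
    have hr : ∀ T ∈ M, ∃ x ∈ X, A x ∩ S = T := by
      intro T hT
      simpa using (mem_filter.1 (mem_filter.1 hT).1).1
    choose! r hrX hrA using hr
    have hle : ∀ B ∈ F, ∃ T ∈ M, B ⊆ T := by
      intro B hB
      obtain ⟨T, hBT, hT⟩ := F.exists_le_maximal hB
      exact ⟨T, mem_filter.2 ⟨hT.prop, hT⟩, hBT⟩
    have hF : ∀ x ∈ X, ∀ j ∈ S, j ∉ A x → A x ∩ S ∈ F := by
      intro x hx j hj hjx
      refine mem_filter.2 ⟨mem_image_of_mem _ hx, fun h => hjx ?_⟩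
      rw [← h] at hj
      exact (mem_inter.1 hj).1
    have mem_r : ∀ T ∈ M, ∀ i, i ∈ T ↔ i ∈ A (r T) ∧ i ∈ S := by
      intro T hT i
      rw [← mem_inter, hrA T hT]
    have hMadj : ∀ T ∈ M, ∀ T' ∈ M, T ≠ T' → G.Adj (r T) (r T') := by
      intro T hT T' hT' hne
      have key : ∀ T ∈ M, ∀ T' ∈ M, T ≠ T' → ∃ i ∈ T, i ∉ T' := by
        intro T hT T' hT' hne
        by_contra! h
        exact hne ((mem_filter.1 hT).2.eq_of_le (mem_filter.1 hT').1 h)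
      obtain ⟨i, hi, hi'⟩ := key T hT T' hT' hne
      obtain ⟨j, hj, hj'⟩ := key T' hT' T hT hne.symm
      rw [mem_r _ hT] at hi hj'
      rw [mem_r _ hT'] at hj hi'
      exact hinc _ (hrX T hT) _ (hrX T' hT') i hi.2 j hj.2 hi.1 (fun h => hi' ⟨h, hi.2⟩) hj.1
        (fun h => hj' ⟨h, hj.2⟩)
    by_cases hMt : t + 1 ≤ #M
    · obtain ⟨M', hM', hcard⟩ := exists_subset_card_eq hMt
      have hinj : Set.InjOn r M' := by
        intro T hT T' hT' h
        rw [← hrA T (hM' hT), ← hrA T' (hM' hT'), h]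
      refine ⟨M'.image r, ?_, ?_, ?_⟩
      · intro x hx
        obtain ⟨T, hT, rfl⟩ := mem_image.1 hx
        exact hrX T (hM' hT)
      · intro x hx y hy hxy
        obtain ⟨T, hT, rfl⟩ := mem_image.1 hx
        obtain ⟨T', hT', rfl⟩ := mem_image.1 hy
        exact hMadj _ (hM' hT) _ (hM' hT') fun h => hxy (by rw [h])
      · rw [card_image_of_injOn hinj, hcard]
    have hcover : ∀ i ∈ S, ∃ T ∈ M, i ∈ T := by
      intro i hi
      obtain ⟨j, hj, hji⟩ := exists_mem_ne hS1 i
      obtain ⟨x, hx, hix, hjx⟩ := hsep i hi j hj hji.symm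
      obtain ⟨T, hT, hxT⟩ := hle _ (hF x hx j hj hjx)
      exact ⟨T, hT, hxT (mem_inter.2 ⟨hix, hi⟩)⟩
    obtain ⟨T₀, hT₀, hT₀card⟩ : ∃ T ∈ M, separatingBound t + 2 * t ≤ #T := by
      by_contra! h
      have h₁ : #S ≤ #(M.biUnion id) := card_le_card fun i hi => by simpa using hcover i hi
      have h₂ := card_biUnion_le_card_mul M id _ fun T hT => (h T hT).le
      have h₃ : #M * (separatingBound t + 2 * t) ≤ (t + 1) * (separatingBound t + 2 * t + 1) :=
        Nat.mul_le_mul (by omega) (by omega)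
      simp only [separatingBound] at hS
      omega
    let S' := T₀ \ (M.erase T₀).biUnion id
    have hS'T : S' ⊆ T₀ := sdiff_subset
    have hT₀S : T₀ ⊆ S := fun i hi => ((mem_r _ hT₀ i).1 hi).2
    have hS' : separatingBound t ≤ #S' := by
      have h₁ : #((M.erase T₀).biUnion fun T => T₀ ∩ T) ≤ #(M.erase T₀) * 2 := by
        refine card_biUnion_le_card_mul _ _ _ fun T hT => ?_
        have hTM := mem_of_mem_erase hT
        refine (card_le_card ?_).trans (hadj _ (hrX _ hT₀) _ (hrX _ hTM)
          (hMadj _ hT₀ _ hTM (ne_of_mem_erase hT).symm))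
        intro i hi
        rw [mem_inter, mem_r _ hT₀, mem_r _ hTM] at hi
        simp [hi]
      have h₂ : #(M.erase T₀) ≤ t := (card_le_card (erase_subset _ _)).trans (by omega)
      have h₃ : T₀ \ S' = (M.erase T₀).biUnion fun T => T₀ ∩ T := by
        simp only [S', sdiff_sdiff_right_self, inf_eq_inter, inter_biUnion, id]
      have h₄ := card_sdiff_add_card_eq_card hS'T
      rw [h₃] at h₄
      omega
    obtain ⟨i, hiS, hiT₀⟩ : ∃ i ∈ S, i ∉ T₀ := by
      by_contra! h
      exact (mem_filter.1 (mem_filter.1 hT₀).1).2 (subset_antisymm hT₀S h)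
    obtain ⟨T₁, hT₁, hiT₁⟩ := hcover i hiS
    have hne : T₁ ≠ T₀ := by rintro rfl; exact hiT₀ hiT₁
    let X' := X.filter fun z => (∃ j ∈ S, j ∉ A z) ∧ ∃ p ∈ S', p ∈ A z
    have hX'adj : ∀ z ∈ X', G.Adj (r T₁) z := by
      intro z hz
      obtain ⟨hzX, ⟨j, hj, hjz⟩, p, hp, hpz⟩ := mem_filter.1 hz
      obtain ⟨T, hT, hzT⟩ := hle _ (hF z hzX j hj hjz)
      have hpS := hT₀S (hS'T hp)
      have hpT := hzT (mem_inter.2 ⟨hpz, hpS⟩)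
      have hpM : ∀ T' ∈ M, T' ≠ T₀ → p ∉ T' := by
        intro T' hT' hne' hpT'
        exact (mem_sdiff.1 hp).2 (mem_biUnion.2 ⟨T', mem_erase.2 ⟨hne', hT'⟩, hpT'⟩)
      have hTT₀ : T = T₀ := by
        by_contra h
        exact hpM T hT h hpT
      subst hTT₀
      exact hinc _ (hrX _ hT₁) _ hzX i hiS p hpS ((mem_r _ hT₁ i).1 hiT₁).1
        (fun h => hiT₀ (hzT (mem_inter.2 ⟨h, hiS⟩))) hpz
        (fun h => hpM T₁ hT₁ hne ((mem_r _ hT₁ p).2 ⟨h, hpS⟩))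
    have hX' : X' ⊆ X := filter_subset _ _
    have hS'S := hS'T.trans hT₀S
    obtain ⟨Y, hYX, hY⟩ := ih S' X' hS'
      (fun p hp q hq hpq => by
        obtain ⟨z, hz, hpz, hqz⟩ := hsep p (hS'S hp) q (hS'S hq) hpq
        exact ⟨z, mem_filter.2 ⟨hz, ⟨q, hS'S hq, hqz⟩, p, hp, hpz⟩, hpz, hqz⟩)
      (fun x hx y hy i hi j hj => hinc x (hX' hx) y (hX' hy) i (hS'S hi) j (hS'S hj))
      (fun x hx y hy hxy => (card_le_card (inter_subset_inter_left hS'S)).trans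
        (hadj x (hX' hx) y (hX' hy) hxy))
    exact ⟨insert (r T₁) Y, insert_subset (hrX _ hT₁) (hYX.trans hX'),
      hY.insert fun z hz => hX'adj z (hYX hz)⟩

open Classical in
/-- If every point lies in at most `d` of the sets `A (X j)` and incomparable sets belong to adjacent
vertices, then `d * t` points yield a clique on `t` vertices. -/
theorem exists_clique_of_bounded_multiplicity {V ι : Type*}
    (G : SimpleGraph V) (A : V → Finset ι) (X : ι → V) (d t : ℕ) : ∀ S : Finset ι,
      d * t ≤ #S → (∀ i ∈ S, i ∈ A (X i)) → (∀ i ∈ S, #{j ∈ S | i ∈ A (X j)} ≤ d) →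
      (∀ x ∈ S, ∀ y ∈ S, ∀ i j, i ∈ A (X x) → i ∉ A (X y) → j ∈ A (X y) → j ∉ A (X x) →
        G.Adj (X x) (X y)) → 0 < d →
      ∃ Y ⊆ S.image X, G.IsNClique t Y := by
  induction t with
  | zero => exact fun S _ _ _ _ _ => ⟨∅, by simp, by simp⟩
  | succ t ih =>
    intro S hS hmem hd hinc hd0
    have hne : S.Nonempty := card_pos.1 (lt_of_lt_of_le (by positivity) hS)
    obtain ⟨i₀, hi₀, hmin⟩ := exists_min_image S (fun i => #(A (X i))) hne
    let S' := S.filter fun j => i₀ ∉ A (X j)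
    have hS' : S' ⊆ S := filter_subset _ _
    have hcard := card_filter_add_card_filter_not (s := S) fun j => i₀ ∈ A (X j)
    have h₀ := hd i₀ hi₀
    obtain ⟨Y, hYS, hY⟩ := ih S' (by rw [mul_add] at hS; simp only [S']; omega)
      (fun i hi => hmem i (hS' hi))
      (fun i hi => (card_le_card (filter_subset_filter _ hS')).trans (hd i (hS' hi)))
      (fun x hx y hy => hinc x (hS' hx) y (hS' hy)) hd0
    refine ⟨insert (X i₀) Y, insert_subset (mem_image_of_mem _ hi₀)
      (hYS.trans (image_subset_image hS')), hY.insert fun z hz => ?_⟩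
    obtain ⟨j, hj, rfl⟩ := mem_image.1 (hYS hz)
    obtain ⟨hjS, hj₀⟩ := mem_filter.1 hj
    obtain ⟨l, hl, hl'⟩ : ∃ l ∈ A (X j), l ∉ A (X i₀) := by
      by_contra! h
      exact hj₀ (eq_of_subset_of_card_le h (hmin j hjS) ▸ hmem i₀ hi₀)
    exact hinc i₀ hi₀ j hjS i₀ l (hmem i₀ hi₀) hj₀ hl hl'

open Classical in
theorem HFree.card_common_le {V : Type*} [Fintype V] {G : SimpleGraph V}
    (hB : HFree coK3Plus2P1 G) {k : ℕ} (hc : G.Colorable k) {u w : V} (huw : G.Adj u w) :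
    #{x | G.Adj u x ∧ G.Adj w x} ≤ 2 * k := by
  obtain ⟨f⟩ := hc
  have := card_le_mul_card_image_of_maps_to (f := f) (s := {x | G.Adj u x ∧ G.Adj w x})
    (t := univ) (fun _ _ => mem_univ _) 2 (by
      intro c _
      by_contra! h
      obtain ⟨x, y, z, hx, hy, hz, hxy, hxz, hyz⟩ := two_lt_card_iff.1 h
      simp only [mem_filter, mem_univ, true_and] at hx hy hz
      have hf {p q : V} (hp : f p = c) (hq : f q = c) : ¬ G.Adj p q :=
        fun hpq => f.valid hpq (hp.trans hq.symm)
      exact hB.not_three_indep_common huw hx.1.1 hy.1.1 hz.1.1 hx.1.2 hy.1.2 hz.1.2 hxy hxz hyz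
        (hf hx.2 hy.2) (hf hx.2 hz.2) (hf hy.2 hz.2))
  simpa using this

/-- The graph induced by `G` on the neighbourhood of `v`, as a graph on all vertices of `G`. -/
def nbhdGraph {V : Type*} (G : SimpleGraph V) (v : V) : SimpleGraph V where
  Adj a b := G.Adj a b ∧ G.Adj v a ∧ G.Adj v b
  symm := ⟨fun _ _ h => ⟨h.1.symm, h.2.2, h.2.1⟩⟩
  loopless := ⟨fun _ h => G.loopless.irrefl _ h.1⟩

section Neighbourhood

variable {V : Type*} {G : SimpleGraph V} {v : V}

theorem NoInducedP5.nbhdGraph (hP : NoInducedP5 G) (v : V) : NoInducedP5 (nbhdGraph G v) := by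
  rintro a b c d e ⟨hab, ha, hb⟩ ⟨hbc, -, hc⟩ ⟨hcd, -, hd⟩ ⟨hde, -, he⟩ hac had hae hbd hbe hce
  exact hP a b c d e hab hbc hcd hde (fun h => hac ⟨h, ha, hc⟩) (fun h => had ⟨h, ha, hd⟩)
    (fun h => hae ⟨h, ha, he⟩) (fun h => hbd ⟨h, hb, hd⟩) (fun h => hbe ⟨h, hb, he⟩)
    (fun h => hce ⟨h, hc, he⟩)

theorem adj_of_nbhdGraph_reachable {a p : V} (ha : G.Adj v a)
    (h : (nbhdGraph G v).Reachable a p) : G.Adj v p := by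
  obtain ⟨w⟩ := h
  induction w with
  | nil => exact ha
  | cons h _ ih => exact ih h.2.2

theorem not_adj_of_not_reachable {a b p q : V} (ha : G.Adj v a) (hb : G.Adj v b)
    (hab : ¬ (nbhdGraph G v).Reachable a b) (hp : (nbhdGraph G v).Reachable a p)
    (hq : (nbhdGraph G v).Reachable b q) : ¬ G.Adj p q := fun h =>
  have hpq : (nbhdGraph G v).Adj p q :=
    ⟨h, adj_of_nbhdGraph_reachable ha hp, adj_of_nbhdGraph_reachable hb hq⟩
  hab (hp.trans (hpq.reachable.trans hq.symm))

/-- `x` distinguishes vertices of the component of `a` in the neighbourhood of `v`. -/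
def IsMixedOn (G : SimpleGraph V) (v x a : V) : Prop :=
  ∃ p q, (nbhdGraph G v).Reachable a p ∧ (nbhdGraph G v).Reachable a q ∧ G.Adj x p ∧ ¬ G.Adj x q

theorem IsMixedOn.exists_adj {x a : V} (h : IsMixedOn G v x a) :
    ∃ p q, (nbhdGraph G v).Reachable a p ∧ (nbhdGraph G v).Reachable a q ∧ G.Adj p q ∧
      G.Adj x p ∧ ¬ G.Adj x q := by
  obtain ⟨p, q, hp, hq, hxp, hxq⟩ := h
  obtain ⟨w⟩ := hp.symm.trans hq
  clear hq
  induction w with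
  | nil => exact absurd hxp hxq
  | @cons p r _ hpr _ ih =>
    have hr := hp.trans (Adj.reachable hpr)
    by_cases hxr : G.Adj x r
    · exact ih hr hxr hxq
    · exact ⟨p, r, hp, hr, hpr.1, hxp, hxr⟩

theorem IsMixedOn.reachable (hP : NoInducedP5 G) {x a b : V} (ha : G.Adj v a) (hb : G.Adj v b)
    (hxa : IsMixedOn G v x a) (hxb : IsMixedOn G v x b) : (nbhdGraph G v).Reachable a b := by
  by_contra hab
  obtain ⟨p, q, hp, hq, hpq, hxp, hxq⟩ := hxa.exists_adj
  obtain ⟨p', q', hp', hq', hpq', hxp', hxq'⟩ := hxb.exists_adj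
  have key {s t} := not_adj_of_not_reachable (p := s) (q := t) ha hb hab
  exact hP q p x p' q' hpq.symm hxp.symm hxp' hpq' (fun h => hxq h.symm) (key hq hp') (key hq hq')
    (key hp hp') (key hp hq') hxq'

theorem adj_of_incomparable (hP : NoInducedP5 G) {a b p q x y : V} (ha : G.Adj v a)
    (hb : G.Adj v b) (hab : ¬ (nbhdGraph G v).Reachable a b)
    (hp : (nbhdGraph G v).Reachable a p) (hq : (nbhdGraph G v).Reachable b q)
    (hvx : ¬ G.Adj v x) (hvy : ¬ G.Adj v y) (hxp : G.Adj x p) (hyp : ¬ G.Adj y p)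
    (hyq : G.Adj y q) (hxq : ¬ G.Adj x q) : G.Adj x y := by
  by_contra hxy
  exact hP x p v q y hxp (adj_of_nbhdGraph_reachable ha hp).symm
    (adj_of_nbhdGraph_reachable hb hq) hyq.symm (fun h => hvx h.symm) hxq hxy
    (not_adj_of_not_reachable ha hb hab hp hq) (fun h => hyp h.symm) hvy

open Classical in
theorem card_mixed_le [Fintype V] (hP : NoInducedP5 G) (hB : HFree coK3Plus2P1 G) {k : ℕ}
    (hc : G.Colorable k) {T : Finset V} (hTv : ∀ a ∈ T, G.Adj v a)
    (hT : ∀ a ∈ T, ∀ b ∈ T, a ≠ b → ¬ (nbhdGraph G v).Reachable a b)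
    (hmix : ∀ a ∈ T, ∃ x, ¬ G.Adj v x ∧ IsMixedOn G v x a) :
    #T ≤ (2 * k + 1) * (k + 1) := by
  by_contra! hcard
  choose! X hXv hX using hmix
  let A : V → Finset V := fun x => {a ∈ T | ∃ p, (nbhdGraph G v).Reachable a p ∧ G.Adj x p}
  have mem_A (x a : V) :
      a ∈ A x ↔ a ∈ T ∧ ∃ p, (nbhdGraph G v).Reachable a p ∧ G.Adj x p := mem_filter
  have hXinj : Set.InjOn X T := by
    intro a ha b hb h
    by_contra hne
    exact hT a ha b hb hne ((hX a ha).reachable hP (hTv a ha) (hTv b hb) (h ▸ hX b hb))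
  obtain ⟨Y, -, hY⟩ := exists_clique_of_bounded_multiplicity G A X (2 * k + 1) (k + 1) T hcard.le
    (fun a ha => by
      obtain ⟨p, q, hp, -, hxp, -⟩ := hX a ha
      exact (mem_A _ _).2 ⟨ha, p, hp, hxp⟩)
    (fun a ha => by
      obtain ⟨p, q, hp, hq, hpq, -⟩ := (hX a ha).exists_adj
      have hsub : image X ({b ∈ T | a ∈ A (X b)}.erase a) ⊆
          ({x | G.Adj p x ∧ G.Adj q x} : Finset V) := by
        intro x hx
        obtain ⟨b, hb, rfl⟩ := mem_image.1 hx
        obtain ⟨hba, hb⟩ := mem_erase.1 hb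
        obtain ⟨hbT, hab⟩ := mem_filter.1 hb
        obtain ⟨-, r, hr, hxr⟩ := (mem_A _ _).1 hab
        have hcomplete : ∀ s, (nbhdGraph G v).Reachable a s → G.Adj s (X b) := by
          intro s hs
          by_contra hxs
          exact hT a ha b hbT (Ne.symm hba) (IsMixedOn.reachable hP (hTv a ha) (hTv b hbT)
            ⟨r, s, hr, hs, hxr, fun h => hxs h.symm⟩ (hX b hbT))
        simp [hcomplete p hp, hcomplete q hq]
      have h₁ := (card_le_card hsub).trans (hB.card_common_le hc hpq)
      rw [card_image_of_injOn (hXinj.mono fun b hb => by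
        exact (mem_filter.1 (mem_erase.1 hb).2).1)] at h₁
      have h₂ := pred_card_le_card_erase (s := {b ∈ T | a ∈ A (X b)}) (a := a)
      omega)
    (fun x hx y hy a b hax hay hby hbx => by
      obtain ⟨ha, p, hp, hxp⟩ := (mem_A _ _).1 hax
      obtain ⟨hb, q, hq, hyq⟩ := (mem_A _ _).1 hby
      have hne : a ≠ b := by rintro rfl; exact hay hby
      exact adj_of_incomparable hP (hTv a ha) (hTv b hb) (hT a ha b hb hne) hp hq (hXv x hx)
        (hXv y hy) hxp (fun h => hay ((mem_A _ _).2 ⟨ha, p, hp, h⟩)) hyq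
        (fun h => hbx ((mem_A _ _).2 ⟨hb, q, hq, h⟩)))
    (by omega)
  have := hY.isClique.card_le_of_colorable hc
  have := hY.card_eq
  omega

theorem exists_adj_not_adj_of_unmixed {n : ℕ} (hn : ¬ G.Colorable n) {a b : V}
    (ha : G.Adj v a) (hab : ¬ (nbhdGraph G v).Reachable a b)
    (hcrit : (G.induce {a}ᶜ).Colorable n)
    (hma : ∀ x, ¬ G.Adj v x → ¬ IsMixedOn G v x a) (hmb : ∀ x, ¬ G.Adj v x → ¬ IsMixedOn G v x b)
    (hχ : (G.induce {p | (nbhdGraph G v).Reachable a p}).chromaticNumber ≤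
      (G.induce {p | (nbhdGraph G v).Reachable b p}).chromaticNumber) :
    ∃ x, ¬ G.Adj v x ∧ G.Adj x a ∧ ¬ G.Adj x b := by
  classical
  by_contra! hx
  apply hn
  obtain ⟨f⟩ := hcrit
  set Ca := {p | (nbhdGraph G v).Reachable a p}
  set Cb := {p | (nbhdGraph G v).Reachable b p}
  have hbne {p} (hp : p ∈ Cb) : p ∉ Ca := fun h => hab (Reachable.trans h (Reachable.symm hp))
  have hane {p} (hp : p ∉ Ca) : p ∈ ({a}ᶜ : Set V) := by
    rintro rfl
    exact hp (Reachable.refl _)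
  let P : Set (Fin n) := {c | ∃ p, ∃ h : p ∈ Cb, f ⟨p, hane (hbne h)⟩ = c}
  have hg : (G.induce Cb).Colorable (Fintype.card P) := by
    refine Coloring.colorable (Coloring.mk
      (fun p => (⟨f ⟨p, hane (hbne p.2)⟩, p, p.2, rfl⟩ : P)) ?_)
    intro p q hpq h
    exact f.valid (v := ⟨p, hane (hbne p.2)⟩) (w := ⟨q, hane (hbne q.2)⟩) hpq
      (congrArg Subtype.val h)
  have hg' : (G.induce Ca).Colorable (Fintype.card P) :=
    chromaticNumber_le_iff_colorable.1 (hχ.trans hg.chromaticNumber_le)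
  let g : (G.induce Ca).Coloring P := hg'.toColoring (by simp)
  have hcross : ∀ p (hp : p ∈ Ca) q (hq : q ∉ Ca), G.Adj p q →
      (g ⟨p, hp⟩ : Fin n) ≠ f ⟨q, hane hq⟩ := by
    intro p hp q hq hpq h
    obtain ⟨r, hr, hfr⟩ := (g ⟨p, hp⟩).2
    have hqr : G.Adj r q := by
      by_cases hvq : G.Adj v q
      · exact absurd (Reachable.trans hp (Adj.reachable
          (⟨hpq, adj_of_nbhdGraph_reachable ha hp, hvq⟩ : (nbhdGraph G v).Adj p q))) hq
      · have hqa : G.Adj q a := by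
          by_contra h'
          exact hma q hvq ⟨p, a, hp, Reachable.refl _, hpq.symm, h'⟩
        by_contra h'
        exact hmb q hvq ⟨b, r, Reachable.refl _, hr, hx q hvq hqa, fun h => h' h.symm⟩
    exact f.valid (v := ⟨r, hane (hbne hr)⟩) (w := ⟨q, hane hq⟩) hqr (hfr.trans h)
  refine ⟨Coloring.mk (fun p => if hp : p ∈ Ca then (g ⟨p, hp⟩ : Fin n) else f ⟨p, hane hp⟩) ?_⟩
  intro p q hpq
  by_cases hp : p ∈ Ca <;> by_cases hq : q ∈ Ca
  · simp only [hp, hq, dif_pos]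
    exact fun h => g.valid (v := ⟨p, hp⟩) (w := ⟨q, hq⟩) hpq (Subtype.ext h)
  · simp only [hp, hq, dif_pos, dif_neg, not_false_iff]
    exact hcross p hp q hq hpq
  · simp only [hp, hq, dif_pos, dif_neg, not_false_iff]
    exact (hcross q hq p hp hpq.symm).symm
  · simp only [hp, hq, dif_neg, not_false_iff]
    exact f.valid (v := ⟨p, hane hp⟩) (w := ⟨q, hane hq⟩) hpq

open Classical in
theorem card_unmixed_le [Fintype V] (hP : NoInducedP5 G) (hB : HFree coK3Plus2P1 G) {n : ℕ}
    (hc : G.Colorable (n + 1)) (hn : ¬ G.Colorable n)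
    (hcrit : ∀ a : V, (G.induce {a}ᶜ).Colorable n) {T : Finset V} (hTv : ∀ a ∈ T, G.Adj v a)
    (hT : ∀ a ∈ T, ∀ b ∈ T, a ≠ b → ¬ (nbhdGraph G v).Reachable a b)
    (hmix : ∀ a ∈ T, ∀ x, ¬ G.Adj v x → ¬ IsMixedOn G v x a) :
    #T ≤ separatingBound (n + 2) * (n + 2) := by
  let χ : V → ℕ∞ := fun a => (G.induce {p | (nbhdGraph G v).Reachable a p}).chromaticNumber
  have hχ : ∀ a, ∃ m : ℕ, m < n + 2 ∧ χ a = m := by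
    intro a
    have h : χ a ≤ (n + 1 : ℕ) :=
      (hc.of_hom (Embedding.induce _).toHom).chromaticNumber_le
    obtain ⟨m, hm⟩ := ENat.ne_top_iff_exists.1 (ne_top_of_le_ne_top (ENat.natCast_ne_top _) h)
    refine ⟨m, ?_, hm.symm⟩
    rw [← hm] at h
    have := Nat.cast_le.1 h
    omega
  choose τ hτ hχτ using hχ
  have := card_le_mul_card_image_of_maps_to (f := τ) (s := T) (t := range (n + 2))
    (fun a _ => mem_range.2 (hτ a)) (separatingBound (n + 2)) (by
      intro m _
      by_contra! h
      have hS {a} (ha : a ∈ ({a ∈ T | τ a = m} : Finset V)) : a ∈ T := (mem_filter.1 ha).1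
      obtain ⟨Y, -, hY⟩ := exists_clique_of_separating G (fun x => {a ∈ T | G.Adj x a}) (n + 2)
        {a ∈ T | τ a = m} {x | ¬ G.Adj v x} h.le
        (fun a ha b hb hne => by
          obtain ⟨x, hvx, hxa, hxb⟩ := exists_adj_not_adj_of_unmixed hn (hTv a (hS ha))
            (hT a (hS ha) b (hS hb) hne) (hcrit a) (hmix a (hS ha))
            (hmix b (hS hb)) (by
              change χ a ≤ χ b
              rw [hχτ, hχτ, (mem_filter.1 ha).2, (mem_filter.1 hb).2])
          exact ⟨x, by simpa using hvx, by simp [hxa, hS ha], by simp [hxb]⟩)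
        (fun x hx y hy a ha b hb hxa hya hyb hxb => by
          simp only [mem_filter, mem_univ, true_and, hS ha, hS hb] at hx hy hxa hya hyb hxb
          have hne : a ≠ b := by rintro rfl; exact hya hyb
          exact adj_of_incomparable hP (hTv a (hS ha)) (hTv b (hS hb))
            (hT a (hS ha) b (hS hb) hne) (Reachable.refl _) (Reachable.refl _) hx hy hxa
            hya hyb hxb)
        (fun x hx y hy hxy => by
          by_contra! h
          obtain ⟨a, b, c, ha, hb, hc, hab, hac, hbc⟩ := two_lt_card_iff.1 h
          simp only [mem_inter, mem_filter] at ha hb hc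
          have hind {a b} (ha : a ∈ T) (hb : b ∈ T) (hab : a ≠ b) : ¬ G.Adj a b :=
            not_adj_of_not_reachable (hTv a ha) (hTv b hb) (hT a ha b hb hab)
              (Reachable.refl _) (Reachable.refl _)
          exact hB.not_three_indep_common hxy ha.1.1.2 hb.1.1.2 hc.1.1.2 ha.1.2.2 hb.1.2.2
            hc.1.2.2 hab hac hbc (hind ha.2.1 hb.2.1 hab) (hind ha.2.1 hc.2.1 hac)
            (hind hb.2.1 hc.2.1 hbc))
      have := hY.isClique.card_le_of_colorable hc
      have := hY.card_eq
      omega)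
  simpa using this

open Classical in
theorem card_neighbors_le [Fintype V] (hP : NoInducedP5 G) (hB : HFree coK3Plus2P1 G) {n : ℕ}
    (hc : G.Colorable (n + 1)) (hn : ¬ G.Colorable n)
    (hcrit : ∀ a : V, (G.induce {a}ᶜ).Colorable n) (v : V) :
    #{a | G.Adj v a} ≤ (2 * (n + 1) + 1) ^ 3 *
      ((2 * (n + 1) + 1) * (n + 1 + 1) + separatingBound (n + 2) * (n + 2)) := by
  let q := (nbhdGraph G v).connectedComponentMk
  let S : Finset V := {a | G.Adj v a}
  have hd : ∀ a, #{b | (nbhdGraph G v).Adj a b} ≤ 2 * (n + 1) := by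
    intro a
    by_cases ha : G.Adj v a
    · refine (card_le_card ?_).trans (hB.card_common_le hc ha)
      intro b hb
      have := (mem_filter.1 hb).2
      simp [this.1, this.2.2]
    · rw [card_eq_zero.2]
      · omega
      · exact filter_eq_empty_iff.2 fun b _ h => ha h.2.1
  have hfib : #S ≤ (2 * (n + 1) + 1) ^ 3 * #(S.image q) := by
    refine card_le_mul_card_image S _ fun C hC => ?_
    obtain ⟨a, -, rfl⟩ := mem_image.1 hC
    refine (card_le_card ?_).trans (card_reachable_le (hP.nbhdGraph v) hd a)
    intro b hb
    exact mem_filter.2 ⟨mem_univ _, (ConnectedComponent.exact (mem_filter.1 hb).2).symm⟩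
  obtain ⟨T, hTS, hinj, himg⟩ := exists_subset_injOn_image_eq_of_surjOn (f := q) (S : Set V)
    (S.image q) (by intro C hC; simpa using hC)
  have hTv : ∀ a ∈ T, G.Adj v a := fun a ha => by simpa [S] using hTS ha
  have hT : ∀ a ∈ T, ∀ b ∈ T, a ≠ b → ¬ (nbhdGraph G v).Reachable a b :=
    fun a ha b hb hne h => hne (hinj ha hb (ConnectedComponent.sound h))
  have hcardT : #(S.image q) = #T := by rw [← himg, card_image_of_injOn hinj]
  have h₁ := card_mixed_le hP hB hc (v := v)
    (T := {a ∈ T | ∃ x, ¬ G.Adj v x ∧ IsMixedOn G v x a})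
    (fun a ha => hTv a (mem_filter.1 ha).1)
    (fun a ha b hb => hT a (mem_filter.1 ha).1 b (mem_filter.1 hb).1)
    (fun a ha => (mem_filter.1 ha).2)
  have h₂ := card_unmixed_le hP hB hc hn hcrit (v := v)
    (T := {a ∈ T | ¬ ∃ x, ¬ G.Adj v x ∧ IsMixedOn G v x a})
    (fun a ha => hTv a (mem_filter.1 ha).1)
    (fun a ha b hb => hT a (mem_filter.1 ha).1 b (mem_filter.1 hb).1)
    (fun a ha x hx h => (mem_filter.1 ha).2 ⟨x, hx, h⟩)
  have h₃ := card_filter_add_card_filter_not (s := T)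
    fun a => ∃ x, ¬ G.Adj v x ∧ IsMixedOn G v x a
  refine hfib.trans (Nat.mul_le_mul_left _ ?_)
  omega

end Neighbourhood

theorem reachable_of_critical {V : Type*} {G : SimpleGraph V} {n : ℕ} (hn : ¬ G.Colorable n)
    (hcrit : ∀ a : V, (G.induce {a}ᶜ).Colorable n) (v w : V) : G.Reachable v w := by
  classical
  by_contra hvw
  obtain ⟨f⟩ := hcrit v
  obtain ⟨g⟩ := hcrit w
  have hg {p} (hp : G.Reachable v p) : p ∈ ({w}ᶜ : Set V) := by
    rintro rfl
    exact hvw hp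
  have hf {p} (hp : ¬ G.Reachable v p) : p ∈ ({v}ᶜ : Set V) := by
    rintro rfl
    exact hp (Reachable.refl _)
  refine hn ⟨Coloring.mk
    (fun p => if hp : G.Reachable v p then g ⟨p, hg hp⟩ else f ⟨p, hf hp⟩) ?_⟩
  intro p q hpq
  by_cases hp : G.Reachable v p
  · have hq := hp.trans hpq.reachable
    simp only [hp, hq, dif_pos]
    exact g.valid (v := ⟨p, hg hp⟩) (w := ⟨q, hg hq⟩) hpq
  · have hq : ¬ G.Reachable v q := fun hq => hp (hq.trans hpq.symm.reachable)
    simp only [hp, hq, dif_neg, not_false_iff]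
    exact f.valid (v := ⟨p, hf hp⟩) (w := ⟨q, hf hq⟩) hpq

theorem stmt17 (k : ℕ) (hk : 1 ≤ k) : ∃ N : ℕ,
    ∀ (V : Type) [Fintype V] (G : SimpleGraph V),
      IsKVertexCritical G k → HFree (pathGraph 5) G → HFree coK3Plus2P1 G →
      Fintype.card V ≤ N := by
  classical
  obtain ⟨n, rfl⟩ : ∃ n, k = n + 1 := ⟨k - 1, by omega⟩
  refine ⟨((2 * (n + 1) + 1) ^ 3 *
    ((2 * (n + 1) + 1) * (n + 1 + 1) + separatingBound (n + 2) * (n + 2)) + 1) ^ 3, ?_⟩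
  intro V _ G ⟨hχ, hχv⟩ hP hB
  have hc : G.Colorable (n + 1) := chromaticNumber_le_iff_colorable.1 hχ.le
  have hn : ¬ G.Colorable n := by
    intro h
    have := h.chromaticNumber_le
    rw [hχ] at this
    have := Nat.cast_le.1 this
    omega
  have hcrit : ∀ a : V, (G.induce {a}ᶜ).Colorable n := fun a =>
    chromaticNumber_le_iff_colorable.1 (Order.le_of_lt_add_one (by simpa using hχv a))
  obtain ⟨v⟩ : Nonempty V := by
    by_contra h
    rw [not_nonempty_iff] at h
    exact hn (Colorable.of_isEmpty n)
  have h := card_reachable_le hP.noInducedP5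
    (card_neighbors_le hP.noInducedP5 hB hc hn hcrit) v
  rwa [filter_true_of_mem fun w _ => reachable_of_critical hn hcrit v w, card_univ] at h
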